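/- arXiv:1904.11071 — 9 statements merged into one kernel-verified Lean document; each statement's English description precedes it below -/
import Mathlib

section
/- Let u and v be nonzero complex numbers with u + v ≠ 0. Then the Jacobi model curve in ℙ³(ℂ) defined by the two quadrics uX² + Y² = Z² and vX² + Z² = T² is smooth; concretely, for every nonzero vector (X,Y,Z,T) ∈ ℂ⁴ satisfying uX² + Y² = Z² and vX² + Z² = T², the two gradient vectors (2uX, 2Y, −2Z, 0) and (2vX, 0, 2Z, −2T) are linearly independent over ℂ. -/
/-- The Jacobi model curve `uX² + Y² = Z²`, `vX² + Z² = T²` in `ℙ³(ℂ)` is smooth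
when `u`, `v`, `u + v` are all nonzero: at every nonzero point of the affine cone,
the gradients of the two defining quadrics are linearly independent. -/
theorem jacobi_model_smooth (u v : ℂ) (hu : u ≠ 0) (hv : v ≠ 0) (huv : u + v ≠ 0)
    (X Y Z T : ℂ) (hne : ![X, Y, Z, T] ≠ 0)
    (h1 : u * X ^ 2 + Y ^ 2 = Z ^ 2) (h2 : v * X ^ 2 + Z ^ 2 = T ^ 2) :
    LinearIndependent ℂ
      ![![2 * u * X, 2 * Y, -2 * Z, 0], ![2 * v * X, 0, 2 * Z, -2 * T]] := by
  rw [LinearIndependent.pair_iff]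
  intro a b hab
  have hX : a * (u * X) + b * (v * X) = 0 := by
    have h : a * (2 * u * X) + b * (2 * v * X) = 0 := by simpa using congrFun hab 0
    linear_combination h / 2
  have hY : a = 0 ∨ Y = 0 := by simpa using congrFun hab 1
  have hZ : (b - a) * Z = 0 := by
    have h : a * (-2 * Z) + b * (2 * Z) = 0 := by simpa using congrFun hab 2
    linear_combination h / 2
  have hT : b = 0 ∨ T = 0 := by simpa using congrFun hab 3
  have hne' : ¬(X = 0 ∧ Y = 0 ∧ Z = 0 ∧ T = 0) := by
    rintro ⟨rfl, rfl, rfl, rfl⟩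
    exact hne (by simp)
  by_cases ha : a = 0
  · subst ha
    refine ⟨rfl, by_contra fun hb => hne' ?_⟩
    simp_all
  · refine (hne' ?_).elim
    obtain rfl := hY.resolve_left ha
    by_cases hb : b = 0
    · subst hb
      obtain rfl : X = 0 := by simpa [ha, hu] using hX
      obtain rfl : Z = 0 := by simpa [ha] using hZ
      exact ⟨rfl, rfl, rfl, pow_eq_zero_iff two_ne_zero |>.mp (by simpa using h2.symm)⟩
    · obtain rfl := hT.resolve_left hb
      have hX0 : X = 0 := by
        have h : (u + v) * X ^ 2 = 0 := by linear_combination h1 + h2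
        simpa [huv] using h
      subst hX0
      exact ⟨rfl, rfl, pow_eq_zero_iff two_ne_zero |>.mp (by simpa using h1.symm), rfl⟩
end

section
/- Let u, v be nonzero complex numbers with u + v ≠ 0, and let P = (X₀,Y₀,Z₀,T₀) and Q = (X₁,Y₁,Z₁,T₁) be vectors in ℂ⁴ each satisfying uX² + Y² = Z² and vX² + Z² = T². Then the vector μ_X(P,Q) = (η₁₂, ω₄₅, ω₆₇, ω₈₉) again satisfies both equations, i.e. u·η₁₂² + ω₄₅² = ω₆₇² and v·η₁₂² + ω₆₇² = ω₈₉², where η₁₂ = X₀²Y₁² − Y₀²X₁², ω₄₅ = X₀Y₀Z₁T₁ − Z₀T₀X₁Y₁, ω₆₇ = X₀Z₀Y₁T₁ − Y₀T₀X₁Z₁, ω₈₉ = X₀T₀Y₁Z₁ − Y₀Z₀X₁T₁. -/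
/-- The biquadratic addition law `μ_X` of the Jacobi model maps pairs of points of the
affine cone of `𝒥_{u,v}` back into the affine cone. -/
theorem jacobi_muX_maps_to_curve (u v : ℂ) (hu : u ≠ 0) (hv : v ≠ 0) (huv : u + v ≠ 0)
    (X₀ Y₀ Z₀ T₀ X₁ Y₁ Z₁ T₁ : ℂ)
    (hP1 : u * X₀ ^ 2 + Y₀ ^ 2 = Z₀ ^ 2) (hP2 : v * X₀ ^ 2 + Z₀ ^ 2 = T₀ ^ 2)
    (hQ1 : u * X₁ ^ 2 + Y₁ ^ 2 = Z₁ ^ 2) (hQ2 : v * X₁ ^ 2 + Z₁ ^ 2 = T₁ ^ 2) :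
    u * (X₀ ^ 2 * Y₁ ^ 2 - Y₀ ^ 2 * X₁ ^ 2) ^ 2
        + (X₀ * Y₀ * Z₁ * T₁ - Z₀ * T₀ * X₁ * Y₁) ^ 2
      = (X₀ * Z₀ * Y₁ * T₁ - Y₀ * T₀ * X₁ * Z₁) ^ 2
    ∧ v * (X₀ ^ 2 * Y₁ ^ 2 - Y₀ ^ 2 * X₁ ^ 2) ^ 2
        + (X₀ * Z₀ * Y₁ * T₁ - Y₀ * T₀ * X₁ * Z₁) ^ 2
      = (X₀ * T₀ * Y₁ * Z₁ - Y₀ * Z₀ * X₁ * T₁) ^ 2 := by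
  have hYZ : Y₀ ^ 2 * Z₁ ^ 2 - Z₀ ^ 2 * Y₁ ^ 2 = -u * (X₀ ^ 2 * Y₁ ^ 2 - Y₀ ^ 2 * X₁ ^ 2) := by
    linear_combination Y₁ ^ 2 * hP1 - Y₀ ^ 2 * hQ1
  have hXZ : X₀ ^ 2 * Z₁ ^ 2 - Z₀ ^ 2 * X₁ ^ 2 = X₀ ^ 2 * Y₁ ^ 2 - Y₀ ^ 2 * X₁ ^ 2 := by
    linear_combination X₁ ^ 2 * hP1 - X₀ ^ 2 * hQ1
  have hXT : X₀ ^ 2 * T₁ ^ 2 - T₀ ^ 2 * X₁ ^ 2 = X₀ ^ 2 * Y₁ ^ 2 - Y₀ ^ 2 * X₁ ^ 2 := by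
    linear_combination X₁ ^ 2 * hP2 - X₀ ^ 2 * hQ2 + hXZ
  have hZT : Z₀ ^ 2 * T₁ ^ 2 - T₀ ^ 2 * Z₁ ^ 2 = -v * (X₀ ^ 2 * Y₁ ^ 2 - Y₀ ^ 2 * X₁ ^ 2) := by
    linear_combination Z₁ ^ 2 * hP2 - Z₀ ^ 2 * hQ2 - v * hXZ
  constructor
  · linear_combination (X₀ ^ 2 * T₁ ^ 2 - T₀ ^ 2 * X₁ ^ 2) * hYZ
      - u * (X₀ ^ 2 * Y₁ ^ 2 - Y₀ ^ 2 * X₁ ^ 2) * hXT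
  · linear_combination (X₀ ^ 2 * Y₁ ^ 2 - Y₀ ^ 2 * X₁ ^ 2) * hZT
end

section
/- Let u, v be nonzero complex numbers with u + v ≠ 0, and let P = (X₀,Y₀,Z₀,T₀) and Q = (X₁,Y₁,Z₁,T₁) be vectors in ℂ⁴ each satisfying uX² + Y² = Z² and vX² + Z² = T². Then the vector μ_Y(P,Q) = (X₀Z₀Y₁T₁ + Y₀T₀X₁Z₁, −uX₀T₀X₁T₁ + Y₀Z₀Y₁Z₁, uvX₀²X₁² + Z₀²Z₁², vX₀Y₀X₁Y₁ + Z₀T₀Z₁T₁) again satisfies both defining equations: writing μ_Y(P,Q) = (A,B,C,D), one has uA² + B² = C² and vA² + C² = D². -/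
/-- The biquadratic addition law `μ_Y` of the Jacobi model maps pairs of points of the
affine cone of `𝒥_{u,v}` back into the affine cone. -/
theorem jacobi_muY_maps_to_curve (u v : ℂ) (hu : u ≠ 0) (hv : v ≠ 0) (huv : u + v ≠ 0)
    (X₀ Y₀ Z₀ T₀ X₁ Y₁ Z₁ T₁ : ℂ)
    (hP1 : u * X₀ ^ 2 + Y₀ ^ 2 = Z₀ ^ 2) (hP2 : v * X₀ ^ 2 + Z₀ ^ 2 = T₀ ^ 2)
    (hQ1 : u * X₁ ^ 2 + Y₁ ^ 2 = Z₁ ^ 2) (hQ2 : v * X₁ ^ 2 + Z₁ ^ 2 = T₁ ^ 2) :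
    u * (X₀ * Z₀ * Y₁ * T₁ + Y₀ * T₀ * X₁ * Z₁) ^ 2
        + (-(u * X₀ * T₀ * X₁ * T₁) + Y₀ * Z₀ * Y₁ * Z₁) ^ 2
      = (u * v * X₀ ^ 2 * X₁ ^ 2 + Z₀ ^ 2 * Z₁ ^ 2) ^ 2
    ∧ v * (X₀ * Z₀ * Y₁ * T₁ + Y₀ * T₀ * X₁ * Z₁) ^ 2
        + (u * v * X₀ ^ 2 * X₁ ^ 2 + Z₀ ^ 2 * Z₁ ^ 2) ^ 2
      = (v * X₀ * Y₀ * X₁ * Y₁ + Z₀ * T₀ * Z₁ * T₁) ^ 2 := by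
  have hY₀ : Y₀ ^ 2 = Z₀ ^ 2 - u * X₀ ^ 2 := by linear_combination hP1
  have hY₁ : Y₁ ^ 2 = Z₁ ^ 2 - u * X₁ ^ 2 := by linear_combination hQ1
  constructor
  · calc
      _ = u * (X₀ ^ 2 * Z₀ ^ 2 * Y₁ ^ 2 * T₁ ^ 2 + Y₀ ^ 2 * T₀ ^ 2 * X₁ ^ 2 * Z₁ ^ 2)
          + u ^ 2 * X₀ ^ 2 * T₀ ^ 2 * X₁ ^ 2 * T₁ ^ 2
          + Y₀ ^ 2 * Z₀ ^ 2 * Y₁ ^ 2 * Z₁ ^ 2 := by ring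
      _ = _ := by
        rw [hY₀, hY₁, ← hP2, ← hQ2]
        ring
  · rw [← sub_eq_zero]
    calc
      _ = v * (X₀ ^ 2 * Z₀ ^ 2 * Y₁ ^ 2 * T₁ ^ 2 + Y₀ ^ 2 * T₀ ^ 2 * X₁ ^ 2 * Z₁ ^ 2)
          + (u * v * X₀ ^ 2 * X₁ ^ 2 + Z₀ ^ 2 * Z₁ ^ 2) ^ 2
          - v ^ 2 * X₀ ^ 2 * Y₀ ^ 2 * X₁ ^ 2 * Y₁ ^ 2
          - Z₀ ^ 2 * T₀ ^ 2 * Z₁ ^ 2 * T₁ ^ 2 := by ring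
      _ = 0 := by
        rw [hY₀, hY₁, ← hP2, ← hQ2]
        ring
end

section
/- Let u, v be nonzero complex numbers with u + v ≠ 0 and set w = −u − v, and let P = (X₀,Y₀,Z₀,T₀) and Q = (X₁,Y₁,Z₁,T₁) be vectors in ℂ⁴ each satisfying uX² + Y² = Z² and vX² + Z² = T². Then the vector μ_Z(P,Q) = (X₀Y₀Z₁T₁ + Z₀T₀X₁Y₁, uwX₀²X₁² + Y₀²Y₁², uX₀T₀X₁T₁ + Y₀Z₀Y₁Z₁, −wX₀Z₀X₁Z₁ + Y₀T₀Y₁T₁) again satisfies both defining equations: writing μ_Z(P,Q) = (A,B,C,D), one has uA² + B² = C² and vA² + C² = D². -/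
/-- The biquadratic addition law `μ_Z` of the Jacobi model maps pairs of points of the
affine cone of `𝒥_{u,v}` back into the affine cone. -/
theorem jacobi_muZ_maps_to_curve (u v w : ℂ) (hu : u ≠ 0) (hv : v ≠ 0) (huv : u + v ≠ 0)
    (hw : w = -u - v)
    (X₀ Y₀ Z₀ T₀ X₁ Y₁ Z₁ T₁ : ℂ)
    (hP1 : u * X₀ ^ 2 + Y₀ ^ 2 = Z₀ ^ 2) (hP2 : v * X₀ ^ 2 + Z₀ ^ 2 = T₀ ^ 2)
    (hQ1 : u * X₁ ^ 2 + Y₁ ^ 2 = Z₁ ^ 2) (hQ2 : v * X₁ ^ 2 + Z₁ ^ 2 = T₁ ^ 2) :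
    u * (X₀ * Y₀ * Z₁ * T₁ + Z₀ * T₀ * X₁ * Y₁) ^ 2
        + (u * w * X₀ ^ 2 * X₁ ^ 2 + Y₀ ^ 2 * Y₁ ^ 2) ^ 2
      = (u * X₀ * T₀ * X₁ * T₁ + Y₀ * Z₀ * Y₁ * Z₁) ^ 2
    ∧ v * (X₀ * Y₀ * Z₁ * T₁ + Z₀ * T₀ * X₁ * Y₁) ^ 2
        + (u * X₀ * T₀ * X₁ * T₁ + Y₀ * Z₀ * Y₁ * Z₁) ^ 2
      = (-(w * X₀ * Z₀ * X₁ * Z₁) + Y₀ * T₀ * Y₁ * T₁) ^ 2 := by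
  subst hw
  constructor <;> grind
end

section
/- Let u, v be nonzero complex numbers with u + v ≠ 0 and set w = −u − v, and let P = (X₀,Y₀,Z₀,T₀) and Q = (X₁,Y₁,Z₁,T₁) be vectors in ℂ⁴ each satisfying uX² + Y² = Z² and vX² + Z² = T². Then the vector μ_T(P,Q) = (u(X₀T₀Y₁Z₁ + Y₀Z₀X₁T₁), u(wX₀Z₀X₁Z₁ + Y₀T₀Y₁T₁), u(−vX₀Y₀X₁Y₁ + Z₀T₀Z₁T₁), −vY₀²Y₁² − wZ₀²Z₁²) again satisfies both defining equations: writing μ_T(P,Q) = (A,B,C,D), one has uA² + B² = C² and vA² + C² = D². -/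
/-- The biquadratic addition law `μ_T` of the Jacobi model maps pairs of points of the
affine cone of `𝒥_{u,v}` back into the affine cone. -/
theorem jacobi_muT_maps_to_curve (u v w : ℂ) (hu : u ≠ 0) (hv : v ≠ 0) (huv : u + v ≠ 0)
    (hw : w = -u - v)
    (X₀ Y₀ Z₀ T₀ X₁ Y₁ Z₁ T₁ : ℂ)
    (hP1 : u * X₀ ^ 2 + Y₀ ^ 2 = Z₀ ^ 2) (hP2 : v * X₀ ^ 2 + Z₀ ^ 2 = T₀ ^ 2)
    (hQ1 : u * X₁ ^ 2 + Y₁ ^ 2 = Z₁ ^ 2) (hQ2 : v * X₁ ^ 2 + Z₁ ^ 2 = T₁ ^ 2) :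
    u * (u * (X₀ * T₀ * Y₁ * Z₁ + Y₀ * Z₀ * X₁ * T₁)) ^ 2
        + (u * (w * X₀ * Z₀ * X₁ * Z₁ + Y₀ * T₀ * Y₁ * T₁)) ^ 2
      = (u * (-(v * X₀ * Y₀ * X₁ * Y₁) + Z₀ * T₀ * Z₁ * T₁)) ^ 2
    ∧ v * (u * (X₀ * T₀ * Y₁ * Z₁ + Y₀ * Z₀ * X₁ * T₁)) ^ 2
        + (u * (-(v * X₀ * Y₀ * X₁ * Y₁) + Z₀ * T₀ * Z₁ * T₁)) ^ 2
      = (-(v * Y₀ ^ 2 * Y₁ ^ 2) - w * Z₀ ^ 2 * Z₁ ^ 2) ^ 2 := by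
  subst hw
  have hT₀ : T₀ ^ 2 = v * X₀ ^ 2 + (u * X₀ ^ 2 + Y₀ ^ 2) := by rw [hP1, hP2]
  have hT₁ : T₁ ^ 2 = v * X₁ ^ 2 + (u * X₁ ^ 2 + Y₁ ^ 2) := by rw [hQ1, hQ2]
  constructor
  · have key : u * (X₀ ^ 2 * T₀ ^ 2 * Y₁ ^ 2 * Z₁ ^ 2 + Y₀ ^ 2 * Z₀ ^ 2 * X₁ ^ 2 * T₁ ^ 2)
        + ((-u - v) ^ 2 * X₀ ^ 2 * Z₀ ^ 2 * X₁ ^ 2 * Z₁ ^ 2 + Y₀ ^ 2 * T₀ ^ 2 * Y₁ ^ 2 * T₁ ^ 2)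
        = v ^ 2 * X₀ ^ 2 * Y₀ ^ 2 * X₁ ^ 2 * Y₁ ^ 2 + Z₀ ^ 2 * T₀ ^ 2 * Z₁ ^ 2 * T₁ ^ 2 := by
      rw [hT₀, hT₁, ← hP1, ← hQ1]
      ring
    linear_combination u ^ 2 * key
  · have key : v * u ^ 2 *
          (X₀ ^ 2 * T₀ ^ 2 * Y₁ ^ 2 * Z₁ ^ 2 + Y₀ ^ 2 * Z₀ ^ 2 * X₁ ^ 2 * T₁ ^ 2)
        + u ^ 2 * (v ^ 2 * X₀ ^ 2 * Y₀ ^ 2 * X₁ ^ 2 * Y₁ ^ 2 + Z₀ ^ 2 * T₀ ^ 2 * Z₁ ^ 2 * T₁ ^ 2)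
        = (-(v * Y₀ ^ 2 * Y₁ ^ 2) - (-u - v) * Z₀ ^ 2 * Z₁ ^ 2) ^ 2 := by
      rw [hT₀, hT₁, ← hP1, ← hQ1]
      ring
    linear_combination key
end

section
/- Let u, v be nonzero complex numbers with u + v ≠ 0 and w = −u − v, and let P and Q be nonzero vectors in ℂ⁴ each satisfying uX² + Y² = Z² and vX² + Z² = T². Then the four addition laws form a complete system: at least one of the four vectors μ_X(P,Q), μ_Y(P,Q), μ_Z(P,Q), μ_T(P,Q) ∈ ℂ⁴ is nonzero. -/
/-- A nonzero point of the affine cone of the Jacobi model has at most one vanishing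
coordinate. -/
theorem jacobi_coordinates_ne_zero {u v X Y Z T : ℂ}
    (hu : u ≠ 0) (hv : v ≠ 0) (huv : u + v ≠ 0) (hne : ![X, Y, Z, T] ≠ 0)
    (h1 : u * X ^ 2 + Y ^ 2 = Z ^ 2) (h2 : v * X ^ 2 + Z ^ 2 = T ^ 2) :
    (X ≠ 0 ∨ Y ≠ 0) ∧ (X ≠ 0 ∨ Z ≠ 0) ∧ (X ≠ 0 ∨ T ≠ 0) ∧
      (Y ≠ 0 ∨ Z ≠ 0) ∧ (Y ≠ 0 ∨ T ≠ 0) ∧ (Z ≠ 0 ∨ T ≠ 0) := by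
  have h0 : ¬(X = 0 ∧ Y = 0 ∧ Z = 0 ∧ T = 0) := by
    rintro ⟨rfl, rfl, rfl, rfl⟩
    exact hne (by simp)
  have h3 : (u + v) * X ^ 2 + Y ^ 2 = T ^ 2 := by linear_combination h1 + h2
  refine ⟨?_, ?_, ?_, ?_, ?_, ?_⟩ <;>
  · by_contra! h
    clear hne
    grind [pow_eq_zero_iff]


/-- The four biquadratic addition laws of the Jacobi model form a complete system:
for any two nonzero points of the affine cone of `𝒥_{u,v}`, at least one of the four
vectors `μ_X(P,Q), μ_Y(P,Q), μ_Z(P,Q), μ_T(P,Q)` is nonzero. -/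
theorem jacobi_addition_laws_complete (u v w : ℂ)
    (hu : u ≠ 0) (hv : v ≠ 0) (huv : u + v ≠ 0) (hw : w = -u - v)
    (X₀ Y₀ Z₀ T₀ X₁ Y₁ Z₁ T₁ : ℂ)
    (hPne : ![X₀, Y₀, Z₀, T₀] ≠ 0) (hQne : ![X₁, Y₁, Z₁, T₁] ≠ 0)
    (hP1 : u * X₀ ^ 2 + Y₀ ^ 2 = Z₀ ^ 2) (hP2 : v * X₀ ^ 2 + Z₀ ^ 2 = T₀ ^ 2)
    (hQ1 : u * X₁ ^ 2 + Y₁ ^ 2 = Z₁ ^ 2) (hQ2 : v * X₁ ^ 2 + Z₁ ^ 2 = T₁ ^ 2) :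
    (![X₀ ^ 2 * Y₁ ^ 2 - Y₀ ^ 2 * X₁ ^ 2,
       X₀ * Y₀ * Z₁ * T₁ - Z₀ * T₀ * X₁ * Y₁,
       X₀ * Z₀ * Y₁ * T₁ - Y₀ * T₀ * X₁ * Z₁,
       X₀ * T₀ * Y₁ * Z₁ - Y₀ * Z₀ * X₁ * T₁] : Fin 4 → ℂ) ≠ 0
    ∨ (![X₀ * Z₀ * Y₁ * T₁ + Y₀ * T₀ * X₁ * Z₁,
         -(u * X₀ * T₀ * X₁ * T₁) + Y₀ * Z₀ * Y₁ * Z₁,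
         u * v * X₀ ^ 2 * X₁ ^ 2 + Z₀ ^ 2 * Z₁ ^ 2,
         v * X₀ * Y₀ * X₁ * Y₁ + Z₀ * T₀ * Z₁ * T₁] : Fin 4 → ℂ) ≠ 0
    ∨ (![X₀ * Y₀ * Z₁ * T₁ + Z₀ * T₀ * X₁ * Y₁,
         u * w * X₀ ^ 2 * X₁ ^ 2 + Y₀ ^ 2 * Y₁ ^ 2,
         u * X₀ * T₀ * X₁ * T₁ + Y₀ * Z₀ * Y₁ * Z₁,
         -(w * X₀ * Z₀ * X₁ * Z₁) + Y₀ * T₀ * Y₁ * T₁] : Fin 4 → ℂ) ≠ 0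
    ∨ (![u * (X₀ * T₀ * Y₁ * Z₁ + Y₀ * Z₀ * X₁ * T₁),
         u * (w * X₀ * Z₀ * X₁ * Z₁ + Y₀ * T₀ * Y₁ * T₁),
         u * (-(v * X₀ * Y₀ * X₁ * Y₁) + Z₀ * T₀ * Z₁ * T₁),
         -(v * Y₀ ^ 2 * Y₁ ^ 2) - w * Z₀ ^ 2 * Z₁ ^ 2] : Fin 4 → ℂ) ≠ 0 := by
  by_contra! h
  obtain ⟨-, hY, hZ, hT⟩ := h
  have hw0 : w ≠ 0 := by
    rintro rfl
    exact huv (by linear_combination hw)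
  simp only [Matrix.cons_eq_zero_iff, mul_eq_zero, hu, false_or] at hY hZ hT
  obtain ⟨-, hY1, -, hY3, -⟩ := hY
  obtain ⟨-, -, hZ2, hZ3, -⟩ := hZ
  obtain ⟨-, hT1, hT2, -, -⟩ := hT
  have hYZ : Y₀ * Z₀ * Y₁ * Z₁ = 0 := by linear_combination (hY1 + hZ2) / 2
  have hZT : Z₀ * T₀ * Z₁ * T₁ = 0 := by linear_combination (hY3 + hT2) / 2
  have hYT : Y₀ * T₀ * Y₁ * T₁ = 0 := by linear_combination (hZ3 + hT1) / 2
  have hXT : u * X₀ * T₀ * X₁ * T₁ = 0 := by linear_combination (hZ2 - hY1) / 2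
  have hXY : v * X₀ * Y₀ * X₁ * Y₁ = 0 := by linear_combination (hY3 - hT2) / 2
  have hXZ : w * X₀ * Z₀ * X₁ * Z₁ = 0 := by linear_combination (hT1 - hZ3) / 2
  have hP := jacobi_coordinates_ne_zero hu hv huv hPne hP1 hP2
  have hQ := jacobi_coordinates_ne_zero hu hv huv hQne hQ1 hQ2
  simp only [mul_eq_zero, hu, hv, hw0, false_or] at hYZ hZT hYT hXT hXY hXZ
  clear hY1 hY3 hZ2 hZ3 hT1 hT2 hP1 hP2 hQ1 hQ2 hPne hQne
  grind
end

section
/- Let u, v be nonzero complex numbers with u + v ≠ 0, and let P = (X₀,Y₀,Z₀,T₀) and Q = (X₁,Y₁,Z₁,T₁) be nonzero vectors in ℂ⁴ each satisfying uX² + Y² = Z² and vX² + Z² = T². Then μ_X(P,Q) = 0 (all four biquadratic components vanish) if and only if Q is a nonzero scalar multiple of one of the four points P, a·P, b·P, ab·P of the G-orbit of P; that is, the exceptional locus of the addition law μ_X is the union of the graphs of the four 2-torsion translations. -/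
/-- If the coordinates of `(X₁, Y₁, Z₁, T₁)` agree with those of `c • (X₀, Y₀, Z₀, T₀)` up to
sign, and one component of `μ_X` vanishes, then the two vectors agree up to a scalar and an element
of `G`. An odd number of sign changes can only occur when some coordinate vanishes. -/
theorem exists_smul_orbit_of_sq_eq {X₀ Y₀ Z₀ T₀ X₁ Y₁ Z₁ T₁ c : ℂ} (hc : c ≠ 0)
    (hX : X₁ = c * X₀) (hY : Y₁ ^ 2 = (c * Y₀) ^ 2) (hZ : Z₁ ^ 2 = (c * Z₀) ^ 2)
    (hT : T₁ ^ 2 = (c * T₀) ^ 2) (hμ : X₀ * Y₀ * Z₁ * T₁ - Z₀ * T₀ * X₁ * Y₁ = 0) :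
    ∃ c : ℂ, c ≠ 0 ∧
        (![X₁, Y₁, Z₁, T₁] = c • ![X₀, Y₀, Z₀, T₀]
        ∨ ![X₁, Y₁, Z₁, T₁] = c • ![X₀, Y₀, -Z₀, -T₀]
        ∨ ![X₁, Y₁, Z₁, T₁] = c • ![X₀, -Y₀, Z₀, -T₀]
        ∨ ![X₁, Y₁, Z₁, T₁] = c • ![X₀, -Y₀, -Z₀, T₀]) := by
  have odd (h : c ^ 2 * (X₀ * Y₀ * Z₀ * T₀) = 0) : X₀ = 0 ∨ Y₀ = 0 ∨ Z₀ = 0 ∨ T₀ = 0 := by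
    simpa [hc, or_assoc] using h
  subst hX
  rcases sq_eq_sq_iff_eq_or_eq_neg.mp hY with rfl | rfl <;>
  rcases sq_eq_sq_iff_eq_or_eq_neg.mp hZ with rfl | rfl <;>
  rcases sq_eq_sq_iff_eq_or_eq_neg.mp hT with rfl | rfl
  case inl.inl.inl | inl.inr.inr | inr.inl.inr | inr.inr.inl => exact ⟨c, hc, by simp⟩
  all_goals
    rcases odd (by first | linear_combination hμ / 2 | linear_combination -hμ / 2) with rfl | rfl | rfl | rfl
    · exact ⟨-c, neg_ne_zero.mpr hc, by simp⟩
    all_goals exact ⟨c, hc, by simp⟩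


/-- The exceptional locus of the addition law `μ_X` on the Jacobi model: for nonzero
points `P`, `Q` of the affine cone, `μ_X(P,Q) = 0` iff `Q` is a nonzero scalar multiple
of one of the four points `P, a·P, b·P, ab·P` of the `G`-orbit of `P`, where
`G ≅ (ℤ/2)²` acts by the sign changes `a·(X,Y,Z,T) = (X,Y,−Z,−T)`,
`b·(X,Y,Z,T) = (X,−Y,Z,−T)`, `ab·(X,Y,Z,T) = (X,−Y,−Z,T)`. -/
theorem jacobi_muX_exceptional_locus (u v : ℂ)
    (hu : u ≠ 0) (hv : v ≠ 0) (huv : u + v ≠ 0)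
    (X₀ Y₀ Z₀ T₀ X₁ Y₁ Z₁ T₁ : ℂ)
    (hPne : ![X₀, Y₀, Z₀, T₀] ≠ 0) (hQne : ![X₁, Y₁, Z₁, T₁] ≠ 0)
    (hP1 : u * X₀ ^ 2 + Y₀ ^ 2 = Z₀ ^ 2) (hP2 : v * X₀ ^ 2 + Z₀ ^ 2 = T₀ ^ 2)
    (hQ1 : u * X₁ ^ 2 + Y₁ ^ 2 = Z₁ ^ 2) (hQ2 : v * X₁ ^ 2 + Z₁ ^ 2 = T₁ ^ 2) :
    (X₀ ^ 2 * Y₁ ^ 2 - Y₀ ^ 2 * X₁ ^ 2 = 0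
      ∧ X₀ * Y₀ * Z₁ * T₁ - Z₀ * T₀ * X₁ * Y₁ = 0
      ∧ X₀ * Z₀ * Y₁ * T₁ - Y₀ * T₀ * X₁ * Z₁ = 0
      ∧ X₀ * T₀ * Y₁ * Z₁ - Y₀ * Z₀ * X₁ * T₁ = 0)
    ↔ ∃ c : ℂ, c ≠ 0 ∧
        (![X₁, Y₁, Z₁, T₁] = c • ![X₀, Y₀, Z₀, T₀]
        ∨ ![X₁, Y₁, Z₁, T₁] = c • ![X₀, Y₀, -Z₀, -T₀]
        ∨ ![X₁, Y₁, Z₁, T₁] = c • ![X₀, -Y₀, Z₀, -T₀]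
        ∨ ![X₁, Y₁, Z₁, T₁] = c • ![X₀, -Y₀, -Z₀, T₀]) := by
  constructor
  · rintro ⟨h, hμ, -, -⟩
    by_cases hX₀ : X₀ = 0
    · subst hX₀
      have hY₀ : Y₀ ≠ 0 := by
        rintro rfl
        have hZ : Z₀ = 0 := by simpa using hP1.symm
        have hT : T₀ = 0 := by simpa [hZ] using hP2.symm
        simp [hZ, hT] at hPne
      have hX₁ : X₁ = 0 := by simpa [hY₀] using h
      subst hX₁
      have hY₁ : Y₁ ≠ 0 := by
        rintro rfl
        have hZ : Z₁ = 0 := by simpa using hQ1.symm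
        have hT : T₁ = 0 := by simpa [hZ] using hQ2.symm
        simp [hZ, hT] at hQne
      obtain ⟨c, rfl⟩ : ∃ c, Y₁ = c * Y₀ := ⟨Y₁ / Y₀, by field_simp⟩
      refine exists_smul_orbit_of_sq_eq (left_ne_zero_of_mul hY₁) (by simp) rfl ?_ ?_ hμ
      · linear_combination c ^ 2 * hP1 - hQ1
      · linear_combination c ^ 2 * (hP1 + hP2) - hQ1 - hQ2
    · have hX₁ : X₁ ≠ 0 := by
        rintro rfl
        have hY : Y₁ = 0 := by simpa [hX₀] using h
        have hZ : Z₁ = 0 := by simpa [hY] using hQ1.symm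
        have hT : T₁ = 0 := by simpa [hZ] using hQ2.symm
        simp [hY, hZ, hT] at hQne
      obtain ⟨c, rfl⟩ : ∃ c, X₁ = c * X₀ := ⟨X₁ / X₀, by field_simp⟩
      have hY : Y₁ ^ 2 = (c * Y₀) ^ 2 :=
        mul_left_cancel₀ (pow_ne_zero 2 hX₀) (by linear_combination h)
      refine exists_smul_orbit_of_sq_eq (left_ne_zero_of_mul hX₁) rfl hY ?_ ?_ hμ
      · linear_combination c ^ 2 * hP1 - hQ1 + hY
      · linear_combination c ^ 2 * (hP1 + hP2) - hQ1 - hQ2 + hY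
  · rintro ⟨c, -, h | h | h | h⟩ <;>
    · simp only [Matrix.smul_cons, smul_eq_mul, Matrix.smul_empty, Matrix.vecCons_inj,
        and_true] at h
      obtain ⟨rfl, rfl, rfl, rfl⟩ := h
      refine ⟨?_, ?_, ?_, ?_⟩ <;> ring
end

section
/- Let a, b, c be complex numbers. The curve ℰ in ℙ³(ℂ) defined by the two quadrics aX² + bY² + cZ² = 0 and X² + Y² + Z² + T² = 0 is smooth if and only if a, b, c are nonzero and pairwise distinct; concretely, the gradients (2aX, 2bY, 2cZ, 0) and (2X, 2Y, 2Z, 2T) are linearly independent over ℂ at every nonzero common solution (X,Y,Z,T) ∈ ℂ⁴ of the two equations if and only if a ≠ 0, b ≠ 0, c ≠ 0, a ≠ b, b ≠ c, and a ≠ c. -/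
/-- If `(s * a + t) * X = 0` and `(s * b + t) * Y = 0` with `t ≠ 0`, where `a` and `b`
are distinct, then `X` or `Y` vanishes. -/
theorem eq_zero_or_eq_zero_of_pencil {K : Type*} [Field K] {a b s t X Y : K}
    (hab : a ≠ b) (ht : t ≠ 0) (hX : (s * a + t) * X = 0) (hY : (s * b + t) * Y = 0) :
    X = 0 ∨ Y = 0 := by
  by_contra! h
  have h₁ := (mul_eq_zero.mp hX).resolve_right h.1
  have h₂ := (mul_eq_zero.mp hY).resolve_right h.2
  have hs : s * (a - b) = 0 := by linear_combination h₁ - h₂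
  have hs : s = 0 := (mul_eq_zero.mp hs).resolve_right (sub_ne_zero.mpr hab)
  exact ht (by simpa [hs] using h₁)

/-- Linear independence of the two gradients, written out in coordinates. -/
theorem linearIndependent_gradients_iff (a b c X Y Z T : ℂ) :
    LinearIndependent ℂ
        ![![2 * a * X, 2 * b * Y, 2 * c * Z, 0], ![2 * X, 2 * Y, 2 * Z, 2 * T]] ↔
      ∀ s t : ℂ, (s * a + t) * X = 0 → (s * b + t) * Y = 0 → (s * c + t) * Z = 0 →
        t * T = 0 → s = 0 ∧ t = 0 := by
  rw [LinearIndependent.pair_iff]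
  refine forall₂_congr fun s t => ⟨fun h h₁ h₂ h₃ h₄ => h ?_, fun h h₀ => ?_⟩
  · ext i
    fin_cases i <;> simp
    · linear_combination 2 * h₁
    · linear_combination 2 * h₂
    · linear_combination 2 * h₃
    · exact mul_eq_zero.mp h₄
  · have h₁ := congrFun h₀ 0
    have h₂ := congrFun h₀ 1
    have h₃ := congrFun h₀ 2
    have h₄ := congrFun h₀ 3
    simp only [Pi.add_apply, Pi.smul_apply, smul_eq_mul, Matrix.cons_val, Pi.zero_apply]
      at h₁ h₂ h₃ h₄
    exact h (by linear_combination h₁ / 2) (by linear_combination h₂ / 2)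
      (by linear_combination h₃ / 2) (by linear_combination h₄ / 2)

/-- The curve `aX² + bY² + cZ² = 0`, `X² + Y² + Z² + T² = 0` in `ℙ³(ℂ)` is smooth
(the gradients of the two quadrics are linearly independent at every nonzero common
solution) if and only if `a`, `b`, `c` are nonzero and pairwise distinct. -/
theorem curve_smooth_iff_coeffs (a b c : ℂ) :
    (∀ X Y Z T : ℂ, ![X, Y, Z, T] ≠ 0 →
      a * X ^ 2 + b * Y ^ 2 + c * Z ^ 2 = 0 →
      X ^ 2 + Y ^ 2 + Z ^ 2 + T ^ 2 = 0 →
      LinearIndependent ℂ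
        ![![2 * a * X, 2 * b * Y, 2 * c * Z, 0], ![2 * X, 2 * Y, 2 * Z, 2 * T]])
    ↔ (a ≠ 0 ∧ b ≠ 0 ∧ c ≠ 0 ∧ a ≠ b ∧ b ≠ c ∧ a ≠ c) := by
  simp only [linearIndependent_gradients_iff]
  constructor
  · intro h
    refine ⟨?_, ?_, ?_, ?_, ?_, ?_⟩ <;> rintro rfl
    · simpa using h 1 0 0 Complex.I (by simp) (by simp) (by simp) 1 0
    · simpa using h 0 1 0 Complex.I (by simp) (by simp) (by simp) 1 0
    · simpa using h 0 0 1 Complex.I (by simp) (by simp) (by simp) 1 0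
    · simpa using h 1 Complex.I 0 0 (by simp) (by simp) (by simp) 1 (-a)
    · simpa using h 0 1 Complex.I 0 (by simp) (by simp) (by simp) 1 (-b)
    · simpa using h 1 0 Complex.I 0 (by simp) (by simp) (by simp) 1 (-a)
  · rintro ⟨ha, hb, hc, hab, hbc, hac⟩ X Y Z T hne - h₂ s t hX hY hZ hT
    by_contra hst
    apply hne
    by_cases ht : t = 0
    · subst ht
      have hs : s ≠ 0 := fun hs => hst ⟨hs, rfl⟩
      obtain rfl : X = 0 := by simpa [hs, ha] using hX
      obtain rfl : Y = 0 := by simpa [hs, hb] using hY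
      obtain rfl : Z = 0 := by simpa [hs, hc] using hZ
      simpa using h₂
    · obtain rfl : T = 0 := (mul_eq_zero.mp hT).resolve_left ht
      rcases eq_zero_or_eq_zero_of_pencil hab ht hX hY with hxy | hxy <;>
      rcases eq_zero_or_eq_zero_of_pencil hbc ht hY hZ with hyz | hyz <;>
      rcases eq_zero_or_eq_zero_of_pencil hac ht hX hZ with hxz | hxz <;>
      simp_all
end

section
/- Let q be a homogeneous quadratic polynomial in the four variables x, y, z, t over ℂ, and set F = q² − xyzt. If p = (0, y, z, t) ∈ ℂ⁴ is a point with first coordinate zero satisfying F(p) = 0, then q(p) = 0 and the three partial derivatives ∂F/∂y, ∂F/∂z, ∂F/∂t all vanish at p, so the gradient of F at p is a scalar multiple of (1,0,0,0) (namely ∇F(p) = (−yzt, 0, 0, 0)). In particular the coordinate line x = 0 is a bitangent of the plane quartic 𝒟: it meets 𝒟 only at tangency points. -/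
open MvPolynomial in
/-- The coordinate line `x = 0` is a bitangent of the plane quartic
`𝒟 : q(x,y,z,t)² = xyzt` (inside the plane `x + y + z + t = 0`): if
`F = q² − xyzt` and `p = (0, y, z, t)` satisfies `F(p) = 0`, then `q(p) = 0`,
the partial derivatives of `F` in `y`, `z`, `t` all vanish at `p`, and the
gradient of `F` at `p` is `(−yzt, 0, 0, 0)`, a scalar multiple of `(1,0,0,0)`. -/
theorem line_x_eq_zero_is_bitangent (q : MvPolynomial (Fin 4) ℂ)
    (hq : q.IsHomogeneous 2)
    (F : MvPolynomial (Fin 4) ℂ)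
    (hF : F = q ^ 2 - (X 0 * X 1 * X 2 * X 3))
    (y z t : ℂ) (p : Fin 4 → ℂ) (hp : p = ![0, y, z, t])
    (hFp : eval p F = 0) :
    eval p q = 0
    ∧ eval p (pderiv 1 F) = 0
    ∧ eval p (pderiv 2 F) = 0
    ∧ eval p (pderiv 3 F) = 0
    ∧ eval p (pderiv 0 F) = -(y * z * t) := by
  subst hF hp
  have hq0 : eval ![0, y, z, t] q = 0 := by simpa using hFp
  refine ⟨hq0, ?_, ?_, ?_, ?_⟩ <;>
    simp [Derivation.leibniz_pow, pderiv_X, hq0]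
  ring
end
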